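/- There exists a universal constant c > 0 with the following property. Let K ⊂ ℝⁿ be a centrally symmetric convex body of volume 1 which is 2-convex with constant α > 0, and suppose K is isotropic. Then c·√α·√n·D_n ⊆ K, where D_n is the Euclidean unit ball of ℝⁿ. In particular the isotropic position of a 2-convex body is a finite volume-ratio position. -/

import Mathlib

open MeasureTheory
open scoped RealInnerProductSpace

noncomputable section

/-- A centrally symmetric convex body: compact, convex, with nonempty interior,
and symmetric about the origin. -/
def IsSymmConvexBody {E : Type*} [NormedAddCommGroup E] [NormedSpace ℝ E]
    (K : Set E) : Prop :=
  IsCompact K ∧ Convex ℝ K ∧ (interior K).Nonempty ∧ K = -K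

/-- The modulus of convexity of `K`, defined via the gauge (Minkowski functional) of `K`. -/
def modulusOfConvexity {E : Type*} [AddCommGroup E] [Module ℝ E]
    (K : Set E) (ε : ℝ) : ℝ :=
  sInf { d | ∃ x y : E, gauge K x ≤ 1 ∧ gauge K y ≤ 1 ∧ ε ≤ gauge K (x - y) ∧
    d = 1 - gauge K ((2:ℝ)⁻¹ • (x + y)) }

/-- `K` is 2-convex with constant `α`: `δ_K(ε) ≥ α ε²` for all `0 < ε ≤ 2`. -/
def IsTwoConvex {E : Type*} [AddCommGroup E] [Module ℝ E]
    (K : Set E) (α : ℝ) : Prop :=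
  ∀ ε : ℝ, 0 < ε → ε ≤ 2 → α * ε ^ 2 ≤ modulusOfConvexity K ε

/-- `K` (of volume 1) is isotropic with isotropic constant `L`:
`∫_K ⟨x,θ⟩² dx = L² |θ|²` for every `θ`. -/
def IsIsotropic {n : ℕ} (K : Set (EuclideanSpace ℝ (Fin n))) (L : ℝ) : Prop :=
  0 < L ∧ ∀ θ : EuclideanSpace ℝ (Fin n),
    ∫ x in K, ⟪x, θ⟫ ^ 2 = L ^ 2 * ‖θ‖ ^ 2


open Set
open scoped ENNReal Pointwise

/-- The one-dimensional Brunn–Minkowski inequality for midpoints. -/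
theorem Real.volume_add_volume_le_two_mul_of_midpoint {A B C : Set ℝ} (hA : MeasurableSet A)
    (hB : MeasurableSet B) (hA₀ : A.Nonempty) (hB₀ : B.Nonempty)
    (hC : ∀ x ∈ A, ∀ y ∈ B, (2 : ℝ)⁻¹ • (x + y) ∈ C) :
    volume A + volume B ≤ 2 * volume C := by
  have key : ∀ A' ⊆ A, IsCompact A' → A'.Nonempty → ∀ B' ⊆ B, IsCompact B' → B'.Nonempty →
      volume A' + volume B' ≤ 2 * volume C := by
    intro A' hAA cA nA B' hBB cB nB
    obtain ⟨a, haA, ha⟩ := cA.exists_isGreatest nA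
    obtain ⟨b, hbB, hb⟩ := cB.exists_isLeast nB
    have hsub : (fun x => x + b) '' A' ∪ (fun y => a + y) '' B' ⊆ (2 : ℝ) • C := by
      rintro _ (⟨x, hx, rfl⟩ | ⟨y, hy, rfl⟩)
      · exact ⟨_, hC x (hAA hx) b (hBB hbB), by simp⟩
      · exact ⟨_, hC a (hAA haA) y (hBB hy), by simp⟩
    have hinter : (fun x => x + b) '' A' ∩ (fun y => a + y) '' B' ⊆ {a + b} := by
      rintro z ⟨⟨x, hx, rfl⟩, ⟨y, hy, hxy⟩⟩
      have h₁ := ha hx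
      have h₂ := hb hy
      simp only [mem_singleton_iff] at *
      linarith
    have hdisj : AEDisjoint volume ((fun x => x + b) '' A') ((fun y => a + y) '' B') :=
      measure_mono_null hinter (by simp)
    have hmeas : NullMeasurableSet ((fun y => a + y) '' B') :=
      (cB.image (by fun_prop)).measurableSet.nullMeasurableSet
    calc volume A' + volume B'
        = volume ((fun x => x + b) '' A') + volume ((fun y => a + y) '' B') := by simp
      _ = volume ((fun x => x + b) '' A' ∪ (fun y => a + y) '' B') :=
          (measure_union₀ hmeas hdisj).symm
      _ ≤ volume ((2 : ℝ) • C) := measure_mono hsub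
      _ = 2 * volume C := by simp [Measure.addHaar_smul]
  obtain ⟨a, ha⟩ := hA₀
  obtain ⟨b, hb⟩ := hB₀
  rw [hA.measure_eq_iSup_isCompact, hB.measure_eq_iSup_isCompact]
  have : Nonempty {s // s ⊆ A ∧ IsCompact s} := ⟨⟨∅, empty_subset _, isCompact_empty⟩⟩
  have : Nonempty {s // s ⊆ B ∧ IsCompact s} := ⟨⟨∅, empty_subset _, isCompact_empty⟩⟩
  simp only [iSup_and', iSup_subtype']
  refine ENNReal.iSup_add_iSup_le fun s t => ?_
  obtain ⟨s, hs, cs⟩ := s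
  obtain ⟨t, ht, ct⟩ := t
  refine le_trans (add_le_add (measure_mono (subset_insert a s)) (measure_mono (subset_insert b t)))
    (key _ (insert_subset ha hs) (cs.insert a) (insert_nonempty _ _) _ (insert_subset hb ht)
      (ct.insert b) (insert_nonempty _ _))

theorem ENNReal.four_mul_le_add_sq (a b : ℝ≥0∞) : 4 * (a * b) ≤ (a + b) ^ 2 := by
  wlog h : a ≤ b generalizing a b
  · rw [mul_comm a b, add_comm a b]
    exact this b a (le_of_not_ge h)
  obtain ⟨d, rfl⟩ := exists_add_of_le h
  calc 4 * (a * (a + d)) ≤ 4 * (a * (a + d)) + d ^ 2 := le_self_add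
    _ = (a + (a + d)) ^ 2 := by ring

/-- The Prékopa–Leindler inequality with weights `1/2` holds for the measure on `E`. -/
def MidpointPrekopaLeindler (E : Type*) [AddCommGroup E] [Module ℝ E] [MeasureSpace E] : Prop :=
  ∀ f g h : E → ℝ≥0∞, Measurable f → Measurable g → Measurable h →
    (∀ x y, f x * g y ≤ h ((2 : ℝ)⁻¹ • (x + y)) ^ 2) →
    (∫⁻ x, f x) * (∫⁻ x, g x) ≤ (∫⁻ x, h x) ^ 2

/-- Prékopa–Leindler on the line for functions whose supremum is `1`. -/
theorem Real.prekopaLeindler_midpoint_of_normalized {f g h : ℝ → ℝ} (hf : Measurable f)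
    (hg : Measurable g) (hh : Measurable h) (hf₀ : 0 ≤ f) (hg₀ : 0 ≤ g) (hh₀ : 0 ≤ h)
    (hf₁ : IsLUB (range f) 1) (hg₁ : IsLUB (range g) 1)
    (hfg : ∀ x y, f x * g y ≤ h ((2 : ℝ)⁻¹ • (x + y)) ^ 2) :
    (∫⁻ x, ENNReal.ofReal (f x)) * (∫⁻ x, ENNReal.ofReal (g x)) ≤
      (∫⁻ x, ENNReal.ofReal (h x)) ^ 2 := by
  have hsum : (∫⁻ x, ENNReal.ofReal (f x)) + (∫⁻ x, ENNReal.ofReal (g x)) ≤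
      2 * ∫⁻ x, ENNReal.ofReal (h x) := by
    rw [lintegral_eq_lintegral_meas_lt _ (.of_forall hf₀) hf.aemeasurable,
      lintegral_eq_lintegral_meas_lt _ (.of_forall hg₀) hg.aemeasurable,
      lintegral_eq_lintegral_meas_lt _ (.of_forall hh₀) hh.aemeasurable,
      ← lintegral_const_mul' _ _ (by simp), ← lintegral_add_left' ]
    · refine setLIntegral_mono' measurableSet_Ioi fun t ht => ?_
      rcases lt_or_ge t 1 with ht₁ | ht₁
      · obtain ⟨_, ⟨x, rfl⟩, hx⟩ := (lt_isLUB_iff hf₁).1 ht₁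
        obtain ⟨_, ⟨y, rfl⟩, hy⟩ := (lt_isLUB_iff hg₁).1 ht₁
        refine Real.volume_add_volume_le_two_mul_of_midpoint (measurableSet_lt measurable_const hf)
          (measurableSet_lt measurable_const hg) ⟨x, hx⟩ ⟨y, hy⟩ fun x hx y hy => ?_
        refine lt_of_pow_lt_pow_left₀ 2 (hh₀ _) (lt_of_lt_of_le ?_ (hfg x y))
        rw [sq]
        exact mul_lt_mul'' hx hy (le_of_lt ht) (le_of_lt ht)
      · have h₁ : {a | t < f a} = ∅ := by
          ext a; simpa using (hf₁.1 ⟨a, rfl⟩).trans ht₁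
        have h₂ : {a | t < g a} = ∅ := by
          ext a; simpa using (hg₁.1 ⟨a, rfl⟩).trans ht₁
        simp [h₁, h₂]
    · refine (Antitone.measurable fun s t hst => measure_mono fun x hx => ?_).aemeasurable
      exact lt_of_le_of_lt hst hx
  have h4 := (ENNReal.four_mul_le_add_sq _ _).trans (pow_le_pow_left' hsum 2)
  rw [mul_pow, show (2 : ℝ≥0∞) ^ 2 = 4 by norm_num] at h4
  exact (ENNReal.mul_le_mul_iff_right (by norm_num) (by norm_num)).1 h4

/-- Prékopa–Leindler on the line for bounded functions. -/
theorem Real.prekopaLeindler_midpoint_of_bddAbove {f g h : ℝ → ℝ} (hf : Measurable f)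
    (hg : Measurable g) (hh : Measurable h) (hf₀ : 0 ≤ f) (hg₀ : 0 ≤ g) (hh₀ : 0 ≤ h)
    (hfb : BddAbove (range f)) (hgb : BddAbove (range g))
    (hfg : ∀ x y, f x * g y ≤ h ((2 : ℝ)⁻¹ • (x + y)) ^ 2) :
    (∫⁻ x, ENNReal.ofReal (f x)) * (∫⁻ x, ENNReal.ofReal (g x)) ≤
      (∫⁻ x, ENNReal.ofReal (h x)) ^ 2 := by
  obtain ⟨a, ha⟩ : ∃ a, IsLUB (range f) a := ⟨_, isLUB_csSup (range_nonempty f) hfb⟩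
  obtain ⟨b, hb⟩ : ∃ b, IsLUB (range g) b := ⟨_, isLUB_csSup (range_nonempty g) hgb⟩
  have ha₀ : 0 ≤ a := (hf₀ 0).trans (ha.1 ⟨0, rfl⟩)
  have hb₀ : 0 ≤ b := (hg₀ 0).trans (hb.1 ⟨0, rfl⟩)
  rcases ha₀.eq_or_lt with rfl | ha₀
  · simp [ENNReal.ofReal_of_nonpos (ha.1 ⟨_, rfl⟩)]
  rcases hb₀.eq_or_lt with rfl | hb₀
  · simp [ENNReal.ofReal_of_nonpos (hb.1 ⟨_, rfl⟩)]
  have hnorm : ∀ {k : ℝ → ℝ} {c : ℝ}, 0 < c → IsLUB (range k) c →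
      IsLUB (range fun x => c⁻¹ * k x) 1 := by
    intro k c hc hk
    have := hk.mul_left (inv_nonneg.2 hc.le)
    rwa [inv_mul_cancel₀ hc.ne', ← range_comp] at this
  have hscale : ∀ {k : ℝ → ℝ} {c : ℝ}, 0 ≤ c →
      ∫⁻ x, ENNReal.ofReal (c * k x) = ENNReal.ofReal c * ∫⁻ x, ENNReal.ofReal (k x) := by
    intro k c hc
    simp_rw [ENNReal.ofReal_mul hc]
    exact lintegral_const_mul' _ _ ENNReal.ofReal_ne_top
  have hs : 0 < √(a * b) := Real.sqrt_pos.2 (mul_pos ha₀ hb₀)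
  have main := Real.prekopaLeindler_midpoint_of_normalized (f := fun x => a⁻¹ * f x)
    (g := fun x => b⁻¹ * g x) (h := fun x => (√(a * b))⁻¹ * h x) (hf.const_mul _) (hg.const_mul _)
    (hh.const_mul _) (fun x => mul_nonneg (inv_nonneg.2 ha₀.le) (hf₀ x))
    (fun x => mul_nonneg (inv_nonneg.2 hb₀.le) (hg₀ x))
    (fun x => mul_nonneg (inv_nonneg.2 hs.le) (hh₀ x)) (hnorm ha₀ ha) (hnorm hb₀ hb) fun x y => by
      rw [mul_pow, inv_pow, Real.sq_sqrt (mul_pos ha₀ hb₀).le, mul_inv]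
      calc a⁻¹ * f x * (b⁻¹ * g y) = a⁻¹ * b⁻¹ * (f x * g y) := by ring
        _ ≤ _ := mul_le_mul_of_nonneg_left (hfg x y) (by positivity)
  rw [hscale (inv_nonneg.2 ha₀.le), hscale (inv_nonneg.2 hb₀.le), hscale (inv_nonneg.2 hs.le),
    mul_mul_mul_comm, mul_pow, ← ENNReal.ofReal_mul (inv_nonneg.2 ha₀.le),
    ← ENNReal.ofReal_pow (inv_nonneg.2 hs.le), inv_pow, Real.sq_sqrt (mul_pos ha₀ hb₀).le,
    ← mul_inv] at main
  exact (ENNReal.mul_le_mul_iff_right (by simpa using mul_pos (inv_pos.2 hb₀) (inv_pos.2 ha₀)) ENNReal.ofReal_ne_top).1 main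

theorem MidpointPrekopaLeindler.real : MidpointPrekopaLeindler ℝ := by
  intro f g h hf hg hh hfg
  have trunc : ∀ {k : ℝ → ℝ≥0∞}, Measurable k →
      ∫⁻ x, k x = ⨆ N : ℕ, ∫⁻ x, min (k x) N := by
    intro k hk
    rw [← lintegral_iSup (fun N => hk.min measurable_const)
      fun M N hMN x => min_le_min le_rfl (Nat.cast_le.2 hMN)]
    refine lintegral_congr fun x => ?_
    rw [← inf_iSup_eq, ENNReal.iSup_natCast, inf_top_eq]
  have bounded : ∀ N : ℕ, (∫⁻ x, min (f x) N) * (∫⁻ x, min (g x) N) ≤ (∫⁻ x, min (h x) N) ^ 2 := by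
    intro N
    have hfin : ∀ (k : ℝ → ℝ≥0∞) x, min (k x) N ≠ ∞ := fun k x =>
      ne_top_of_le_ne_top (ENNReal.natCast_ne_top N) (min_le_right _ _)
    have hbdd : ∀ k : ℝ → ℝ≥0∞, BddAbove (range fun x => (min (k x) N).toReal) := by
      rintro k
      refine ⟨N, ?_⟩
      rintro _ ⟨x, rfl⟩
      exact ENNReal.toReal_le_of_le_ofReal (by positivity) (by simp)
    have main := Real.prekopaLeindler_midpoint_of_bddAbove
      (f := fun x => (min (f x) N).toReal) (g := fun x => (min (g x) N).toReal)
      (h := fun x => (min (h x) N).toReal) (hf.min measurable_const).ennreal_toReal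
      (hg.min measurable_const).ennreal_toReal (hh.min measurable_const).ennreal_toReal
      (fun _ => ENNReal.toReal_nonneg) (fun _ => ENNReal.toReal_nonneg)
      (fun _ => ENNReal.toReal_nonneg) (hbdd f) (hbdd g) fun x y => by
        rw [← ENNReal.toReal_mul, ← ENNReal.toReal_pow]
        refine ENNReal.toReal_mono (ENNReal.pow_ne_top (hfin _ _)) ?_
        rcases le_total (h ((2 : ℝ)⁻¹ • (x + y))) N with hle | hle
        · rw [min_eq_left hle]
          exact (mul_le_mul' (min_le_left _ _) (min_le_left _ _)).trans (hfg x y)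
        · rw [min_eq_right hle, sq]
          exact mul_le_mul' (min_le_right _ _) (min_le_right _ _)
    simpa only [ENNReal.ofReal_toReal (hfin _ _)] using main
  rw [trunc hf, trunc hg, ENNReal.iSup_mul]
  refine iSup_le fun M => ?_
  rw [ENNReal.mul_iSup]
  refine iSup_le fun N => le_trans (mul_le_mul' ?_ ?_)
    ((bounded (max M N)).trans (pow_le_pow_left' (lintegral_mono fun x => min_le_left _ _) 2)) <;>
  exact lintegral_mono fun x => min_le_min le_rfl (by simp)

theorem MidpointPrekopaLeindler.prod {E F : Type*} [AddCommGroup E] [Module ℝ E] [MeasureSpace E]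
    [AddCommGroup F] [Module ℝ F] [MeasureSpace F] [SFinite (volume : Measure F)]
    [SFinite (volume : Measure E)]
    (hE : MidpointPrekopaLeindler E) (hF : MidpointPrekopaLeindler F) :
    MidpointPrekopaLeindler (E × F) := by
  intro f g h hf hg hh hfg
  rw [Measure.volume_eq_prod, lintegral_prod _ hf.aemeasurable, lintegral_prod _ hg.aemeasurable,
    lintegral_prod _ hh.aemeasurable]
  refine hE _ _ _ hf.lintegral_prod_right' hg.lintegral_prod_right' hh.lintegral_prod_right'
    fun x y => ?_
  exact hF _ _ _ (hf.comp measurable_prodMk_left) (hg.comp measurable_prodMk_left)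
    (hh.comp measurable_prodMk_left) fun u v => hfg (x, u) (y, v)

theorem MidpointPrekopaLeindler.of_measurePreserving {E F : Type*} [AddCommGroup E] [Module ℝ E]
    [MeasureSpace E] [AddCommGroup F] [Module ℝ F] [MeasureSpace F]
    (hE : MidpointPrekopaLeindler E) (e : E →ₗ[ℝ] F) (he : MeasurePreserving e) :
    MidpointPrekopaLeindler F := by
  intro f g h hf hg hh hfg
  rw [← he.lintegral_comp hf, ← he.lintegral_comp hg, ← he.lintegral_comp hh]
  refine hE _ _ _ (hf.comp he.measurable) (hg.comp he.measurable) (hh.comp he.measurable)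
    fun x y => ?_
  simpa using hfg (e x) (e y)

theorem MidpointPrekopaLeindler.pi : ∀ n : ℕ, MidpointPrekopaLeindler (Fin n → ℝ)
  | 0 => by
    intro f g h hf hg hh hfg
    have hzero : (2 : ℝ)⁻¹ • (default + default : Fin 0 → ℝ) = default := Subsingleton.elim _ _
    rw [volume_pi, Measure.pi_of_empty _ default]
    simp only [lintegral_dirac]
    simpa only [hzero] using hfg default default
  | n + 1 => by
    refine (MidpointPrekopaLeindler.real.prod (MidpointPrekopaLeindler.pi n)).of_measurePreserving
      (E := ℝ × (Fin n → ℝ)) (F := Fin (n + 1) → ℝ)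
      { toFun := (MeasurableEquiv.piFinSuccAbove (fun _ : Fin (n + 1) => ℝ) 0).symm
        map_add' := fun x y => ?_
        map_smul' := fun c x => ?_ } (volume_preserving_piFinSuccAbove (fun _ => ℝ) 0).symm
    · ext i; refine Fin.cases ?_ (fun j => ?_) i <;> simp [MeasurableEquiv.piFinSuccAbove]
    · ext i; refine Fin.cases ?_ (fun j => ?_) i <;> simp [MeasurableEquiv.piFinSuccAbove]

theorem MidpointPrekopaLeindler.euclideanSpace (n : ℕ) :
    MidpointPrekopaLeindler (EuclideanSpace ℝ (Fin n)) :=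
  (MidpointPrekopaLeindler.pi n).of_measurePreserving
    (WithLp.linearEquiv 2 ℝ (Fin n → ℝ)).symm.toLinearMap (PiLp.volume_preserving_toLp (Fin n))

/-- The multiplicative Brunn–Minkowski inequality for midpoints. -/
theorem MidpointPrekopaLeindler.measure_mul_le {E : Type*} [AddCommGroup E] [Module ℝ E]
    [MeasureSpace E] (hE : MidpointPrekopaLeindler E) {A B C : Set E} (hA : MeasurableSet A)
    (hB : MeasurableSet B) (hC : MeasurableSet C)
    (h : ∀ x ∈ A, ∀ y ∈ B, (2 : ℝ)⁻¹ • (x + y) ∈ C) :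
    volume A * volume B ≤ volume C ^ 2 := by
  have := hE (A.indicator 1) (B.indicator 1) (C.indicator 1) (measurable_one.indicator hA)
    (measurable_one.indicator hB) (measurable_one.indicator hC) fun x y => by
      by_cases hx : x ∈ A
      · by_cases hy : y ∈ B
        · rw [indicator_of_mem hx, indicator_of_mem hy, indicator_of_mem (h x hx y hy)]; simp
        · simp [hy]
      · simp [hx]
  simpa [lintegral_indicator_one, hA, hB, hC] using this

section ConvexBody

variable {E : Type*} [NormedAddCommGroup E] [NormedSpace ℝ E] {K : Set E}

theorem IsSymmConvexBody.neg_mem (hK : IsSymmConvexBody K) {x : E} (hx : x ∈ K) : -x ∈ K := by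
  rw [hK.2.2.2]
  simpa using hx

theorem IsSymmConvexBody.mem_nhds_zero (hK : IsSymmConvexBody K) : K ∈ nhds (0 : E) := by
  obtain ⟨x, hx⟩ := hK.2.2.1
  have := hK.2.1.combo_interior_self_mem_interior hx (hK.neg_mem (interior_subset hx))
    (a := 2⁻¹) (b := 2⁻¹) (by norm_num) (by norm_num) (by norm_num)
  rw [smul_neg, add_neg_cancel] at this
  exact mem_interior_iff_mem_nhds.1 this

theorem IsSymmConvexBody.gauge_le_one_iff (hK : IsSymmConvexBody K) {x : E} :
    gauge K x ≤ 1 ↔ x ∈ K := by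
  rw [gauge_le_one_iff_mem_closure hK.2.1 hK.mem_nhds_zero, hK.1.isClosed.closure_eq]

theorem IsSymmConvexBody.mem_smul_of_gauge_le (hK : IsSymmConvexBody K) {x : E} {r : ℝ}
    (hr : 0 < r) (hx : gauge K x ≤ r) : x ∈ r • K := by
  rw [mem_smul_set_iff_inv_smul_mem₀ hr.ne', ← hK.gauge_le_one_iff,
    gauge_smul_of_nonneg (inv_nonneg.2 hr.le), smul_eq_mul, inv_mul_le_one₀ hr]
  exact hx

theorem IsTwoConvex.gauge_midpoint_le (hK : IsSymmConvexBody K) {α : ℝ} (hα : IsTwoConvex K α)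
    {x y : E} (hx : x ∈ K) (hy : y ∈ K) {ε : ℝ} (hε : 0 < ε) (hε₂ : ε ≤ 2)
    (hxy : ε ≤ gauge K (x - y)) : gauge K ((2 : ℝ)⁻¹ • (x + y)) ≤ 1 - α * ε ^ 2 := by
  have hle : modulusOfConvexity K ε ≤ 1 - gauge K ((2 : ℝ)⁻¹ • (x + y)) := by
    refine csInf_le ⟨0, ?_⟩
      ⟨x, y, hK.gauge_le_one_iff.2 hx, hK.gauge_le_one_iff.2 hy, hxy, rfl⟩
    rintro _ ⟨a, b, ha, hb, -, rfl⟩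
    have hadd := gauge_add_le hK.2.1 (absorbent_nhds_zero hK.mem_nhds_zero) a b
    rw [gauge_smul_of_nonneg (by norm_num), smul_eq_mul]
    linarith
  linarith [hα ε hε hε₂]

end ConvexBody

variable {n : ℕ} {K : Set (EuclideanSpace ℝ (Fin n))}

/-- Caps of a 2-convex body have exponentially small volume. -/
theorem IsTwoConvex.volume_cap_le (hK : IsSymmConvexBody K) (hvol : volume K = 1) {α : ℝ}
    (hα : IsTwoConvex K α) {θ : EuclideanSpace ℝ (Fin n)} {u : ℝ} (hu : ∀ x ∈ K, ⟪x, θ⟫ < u)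
    {t : ℝ} (ht : 0 < t) :
    volume {x ∈ K | t * u ≤ ⟪x, θ⟫} ≤ ENNReal.ofReal (Real.exp (-(4 * α * n * t ^ 2))) := by
  set A := {x ∈ K | t * u ≤ ⟪x, θ⟫} with hA
  have hu₀ : 0 < u := by simpa using hu 0 (mem_of_mem_nhds hK.mem_nhds_zero)
  have hAm : MeasurableSet A :=
    hK.1.measurableSet.inter <| measurableSet_le measurable_const
      (by fun_prop : Measurable fun x : EuclideanSpace ℝ (Fin n) => ⟪x, θ⟫)
  rcases lt_or_ge 1 t with ht₁ | ht₁
  · have : A = ∅ := by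
      ext x
      simp only [hA, mem_ofPred_eq, mem_empty_iff_false, iff_false, not_and, not_le]
      exact fun hx => (hu x hx).trans (by nlinarith)
    simp [this]
  set ρ := Real.exp (-(4 * α * t ^ 2)) with hρ
  have hρ₀ : 0 < ρ := Real.exp_pos _
  have hmid : ∀ x ∈ A, ∀ y ∈ -A, (2 : ℝ)⁻¹ • (x + y) ∈ ρ • K := by
    rintro x ⟨hxK, hx⟩ y ⟨hyK, hy⟩
    have hyK' : y ∈ K := by simpa using hK.neg_mem hyK
    refine hK.mem_smul_of_gauge_le hρ₀ ?_
    have hdist : 2 * t ≤ gauge K (x - y) := by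
      by_contra! hlt
      obtain ⟨z, hz, hzx⟩ := hK.mem_smul_of_gauge_le (by positivity) hlt.le
      have h₁ := hu z hz
      have h₂ : ⟪x - y, θ⟫ = 2 * t * ⟪z, θ⟫ := by rw [← hzx]; simp [inner_smul_left]
      rw [inner_sub_left] at h₂
      rw [inner_neg_left] at hy
      nlinarith
    refine (hα.gauge_midpoint_le hK hxK hyK' (by positivity) (by linarith) hdist).trans ?_
    have := Real.add_one_le_exp (-(4 * α * t ^ 2))
    rw [hρ]
    linarith
  have hBM := (MidpointPrekopaLeindler.euclideanSpace n).measure_mul_le hAm hAm.neg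
    (hK.1.smul ρ).measurableSet hmid
  rw [Measure.measure_neg, ← sq, Measure.addHaar_smul, hvol, mul_one] at hBM
  refine ((ENNReal.pow_le_pow_left_iff two_ne_zero).1 hBM).trans_eq ?_
  rw [abs_of_pos (by positivity), finrank_euclideanSpace_fin, hρ, ← Real.exp_nat_mul]
  congr 2
  ring

/-- Second moments of a 2-convex body are controlled by its width. -/
theorem IsTwoConvex.integral_inner_sq_le (hn : 0 < n) (hK : IsSymmConvexBody K)
    (hvol : volume K = 1) {α : ℝ} (hα₀ : 0 < α) (hα : IsTwoConvex K α)
    {θ : EuclideanSpace ℝ (Fin n)} {u : ℝ} (hu : ∀ x ∈ K, ⟪x, θ⟫ < u) :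
    ∫ x in K, ⟪x, θ⟫ ^ 2 ≤ u ^ 2 / (2 * α * n) := by
  have hu₀ : 0 < u := by simpa using hu 0 (mem_of_mem_nhds hK.mem_nhds_zero)
  have hn' : (0 : ℝ) < n := Nat.cast_pos.2 hn
  have hneg : -(4 * α * n / u ^ 2) < 0 := neg_lt_zero.2 (by positivity)
  have hmeas : Measurable fun x : EuclideanSpace ℝ (Fin n) => ⟪x, θ⟫ ^ 2 := by fun_prop
  have hlevel : ∀ s ∈ Ioi (0 : ℝ), volume.restrict K {x | s ≤ ⟪x, θ⟫ ^ 2} ≤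
      ENNReal.ofReal (2 * Real.exp (-(4 * α * n / u ^ 2) * s)) := by
    intro s hs
    have hs' : 0 < √s := Real.sqrt_pos.2 hs
    set A := {x ∈ K | √s / u * u ≤ ⟪x, θ⟫} with hA
    have hsub : {x | s ≤ ⟪x, θ⟫ ^ 2} ∩ K ⊆ A ∪ -A := by
      rintro x ⟨hx, hxK⟩
      rw [mem_ofPred_eq, ← sq_abs, ← Real.sqrt_le_left (abs_nonneg _)] at hx
      rcases le_abs.1 hx with h | h
      · exact Or.inl ⟨hxK, by rwa [div_mul_cancel₀ _ hu₀.ne']⟩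
      · exact Or.inr ⟨hK.neg_mem hxK, by rwa [div_mul_cancel₀ _ hu₀.ne', inner_neg_left]⟩
    have hexp : -(4 * α * n * (√s / u) ^ 2) = -(4 * α * n / u ^ 2) * s := by
      rw [div_pow, Real.sq_sqrt (le_of_lt hs)]
      ring
    have hcap := hα.volume_cap_le hK hvol hu (div_pos hs' hu₀)
    rw [hexp] at hcap
    rw [Measure.restrict_apply (measurableSet_le measurable_const hmeas)]
    calc volume ({x | s ≤ ⟪x, θ⟫ ^ 2} ∩ K) ≤ volume A + volume (-A) :=
          (measure_mono hsub).trans (measure_union_le _ _)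
      _ = 2 * volume A := by rw [Measure.measure_neg, two_mul]
      _ ≤ _ := by
        rw [ENNReal.ofReal_mul zero_le_two, ENNReal.ofReal_ofNat]
        exact mul_le_mul_right hcap 2
  have hint : Integrable (fun s => 2 * Real.exp (-(4 * α * n / u ^ 2) * s))
      (volume.restrict (Ioi 0)) := (integrableOn_exp_mul_Ioi hneg 0).const_mul 2
  rw [integral_eq_lintegral_of_nonneg_ae (.of_forall fun x => sq_nonneg _)
    hmeas.aestronglyMeasurable]
  refine ENNReal.toReal_le_of_le_ofReal (by positivity) ?_
  rw [lintegral_eq_lintegral_meas_le _ (.of_forall fun x => sq_nonneg _) hmeas.aemeasurable]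
  refine (setLIntegral_mono' measurableSet_Ioi hlevel).trans_eq ?_
  rw [← ofReal_integral_eq_lintegral_ofReal hint (.of_forall fun s => by positivity),
    integral_const_mul, integral_exp_mul_Ioi hneg, mul_zero, Real.exp_zero]
  congr 1
  field_simp
  norm_num

/-- The second moment of an isotropic body about the origin. -/
theorem IsIsotropic.integral_norm_sq {L : ℝ} (hL : IsIsotropic K L) (hK : IsCompact K) :
    ∫ x in K, ‖x‖ ^ 2 = n * L ^ 2 := by
  have hcoord : ∀ i : Fin n, ∫ x in K, (x i) ^ 2 = L ^ 2 := by
    intro i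
    simpa [EuclideanSpace.inner_single_right] using hL.2 (EuclideanSpace.single i 1)
  simp_rw [EuclideanSpace.real_norm_sq_eq]
  rw [integral_finsetSum]
  · simp [hcoord]
  · exact fun i _ => ContinuousOn.integrableOn_compact hK (by fun_prop)

/-- The isotropic constant of a body of volume one is at least `(2πe)^{-1/2}`. -/
theorem IsIsotropic.inv_two_pi_exp_le_sq (hn : 0 < n) {L : ℝ} (hL : IsIsotropic K L)
    (hK : IsCompact K) (hvol : volume K = 1) : 1 / (2 * Real.pi * Real.exp 1) ≤ L ^ 2 := by
  set b := Real.pi * Real.exp 1 with hb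
  have hb₀ : 0 < b := mul_pos Real.pi_pos (Real.exp_pos _)
  set m := b * (n * L ^ 2) with hm
  have hreal : volume.real K = 1 := by simp [measureReal_def, hvol]
  have hgauss : ∫ v : EuclideanSpace ℝ (Fin n), Real.exp (-b * ‖v‖ ^ 2) =
      Real.exp (-(n / 2 : ℝ)) := by
    rw [GaussianFourier.integral_rexp_neg_mul_sq_norm hb₀, finrank_euclideanSpace_fin, hb,
      div_mul_cancel_left₀ Real.pi_ne_zero, ← Real.exp_neg, ← Real.exp_mul]
    congr 1
    ring
  have hgint : Integrable fun v : EuclideanSpace ℝ (Fin n) => Real.exp (-b * ‖v‖ ^ 2) := by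
    refine Integrable.of_integral_ne_zero ?_
    rw [hgauss]
    positivity
  have hlower : Real.exp (-m) ≤ ∫ x in K, Real.exp (-b * ‖x‖ ^ 2) := by
    have hsq : IntegrableOn (fun x : EuclideanSpace ℝ (Fin n) => ‖x‖ ^ 2) K :=
      ContinuousOn.integrableOn_compact hK (by fun_prop)
    have hconst : IntegrableOn (fun _ : EuclideanSpace ℝ (Fin n) => 1 + m) K :=
      ContinuousOn.integrableOn_compact hK (by fun_prop)
    calc Real.exp (-m) = ∫ x in K, Real.exp (-m) * (1 + m - b * ‖x‖ ^ 2) := by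
          rw [integral_const_mul, integral_sub hconst (hsq.const_mul b), integral_const_mul,
            hL.integral_norm_sq hK, setIntegral_const, hreal, ← hm]
          simp
      _ ≤ ∫ x in K, Real.exp (-b * ‖x‖ ^ 2) := by
          refine integral_mono ((hconst.sub (hsq.const_mul b)).const_mul _) hgint.integrableOn
            fun x => ?_
          have hle := Real.add_one_le_exp (m - b * ‖x‖ ^ 2)
          calc Real.exp (-m) * (1 + m - b * ‖x‖ ^ 2)
              ≤ Real.exp (-m) * Real.exp (m - b * ‖x‖ ^ 2) :=
                mul_le_mul_of_nonneg_left (by linarith) (Real.exp_pos _).le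
            _ = Real.exp (-b * ‖x‖ ^ 2) := by rw [← Real.exp_add]; congr 1; ring
  have hupper := setIntegral_le_integral (s := K) hgint (.of_forall fun x => (Real.exp_pos _).le)
  rw [hgauss] at hupper
  have hexp := Real.exp_le_exp.1 (hlower.trans hupper)
  have hn' : (0 : ℝ) < n := Nat.cast_pos.2 hn
  rw [mul_assoc, ← hb, div_le_iff₀ (by positivity)]
  refine le_of_mul_le_mul_left ?_ hn'
  linarith

theorem twoConvex_isotropic_finite_volume_ratio :
    ∃ c : ℝ, 0 < c ∧ ∀ (n : ℕ) (K : Set (EuclideanSpace ℝ (Fin n))) (α : ℝ),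
      0 < n → IsSymmConvexBody K → volume K = 1 → 0 < α → IsTwoConvex K α →
      (∃ L : ℝ, IsIsotropic K L) →
      Metric.closedBall (0 : EuclideanSpace ℝ (Fin n))
        (c * Real.sqrt α * Real.sqrt n) ⊆ K := by
  refine ⟨1 / 4, by norm_num, fun n K α hn hK hvol hα₀ hα ⟨L, hL⟩ x₀ hx₀ => ?_⟩
  by_contra hx₀K
  have hn' : (0 : ℝ) < n := Nat.cast_pos.2 hn
  obtain ⟨f, u, hfu, hux⟩ := geometric_hahn_banach_closed_point hK.2.1 hK.1.isClosed hx₀K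
  set θ := (InnerProductSpace.toDual ℝ (EuclideanSpace ℝ (Fin n))).symm f with hθ
  have hf : ∀ x, f x = ⟪x, θ⟫ := fun x => by
    rw [real_inner_comm, hθ, InnerProductSpace.toDual_symm_apply]
  have hu : ∀ x ∈ K, ⟪x, θ⟫ < u := fun x hx => hf x ▸ hfu x hx
  have hu₀ : 0 < u := by simpa using hu 0 (mem_of_mem_nhds hK.mem_nhds_zero)
  have hmoment := hα.integral_inner_sq_le hn hK hvol hα₀ hu
  rw [hL.2 θ, le_div_iff₀ (by positivity)] at hmoment
  have huθ : u ≤ 1 / 4 * √α * √n * ‖θ‖ := by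
    rw [hf] at hux
    refine (hux.le.trans (real_inner_le_norm _ _)).trans ?_
    exact mul_le_mul_of_nonneg_right (by simpa using hx₀) (norm_nonneg _)
  have husq : u ^ 2 ≤ 1 / 16 * (α * n * ‖θ‖ ^ 2) := by
    refine (pow_le_pow_left₀ hu₀.le huθ 2).trans_eq ?_
    rw [mul_pow, mul_pow, mul_pow, Real.sq_sqrt hα₀.le, Real.sq_sqrt hn'.le]
    ring
  have hθ₀ : 0 < ‖θ‖ := by
    by_contra! h
    have : ‖θ‖ = 0 := le_antisymm h (norm_nonneg _)
    rw [this, mul_zero] at huθ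
    linarith
  have hL_le : L ^ 2 ≤ 1 / 32 := by
    refine le_of_mul_le_mul_right ?_ (show 0 < α * n * ‖θ‖ ^ 2 by positivity)
    linarith
  have hL_ge := hL.inv_two_pi_exp_le_sq hn hK.1 hvol
  have hpe : 2 * Real.pi * Real.exp 1 < 32 := by
    nlinarith [Real.pi_lt_d2, Real.exp_one_lt_d9, Real.pi_pos, Real.exp_pos 1]
  have := one_div_lt_one_div_of_lt (by positivity) hpe
  linarith
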